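/- Let α, β ∈ (0,1) be irrational. If the one-sided Sturmian subshifts (X_α, σ_α) and (X_β, σ_β) are continuously orbit equivalent, then they are conjugate (and hence α = β or α = 1 − β). -/

import Mathlib

noncomputable section

open Set

/-! ### Sturmian sequences and subshifts -/

/-- The Sturmian coding of a real number `t`: `false` (the symbol `0`) if the fractional
part of `t` lies in `[0, 1 - α)`, and `true` (the symbol `1`) if it lies in `[1 - α, 1)`. -/
def sturmianCode (α t : ℝ) : Bool := decide (1 - α ≤ Int.fract t)

/-- The one-sided Sturmian sequence with parameter `α` and starting point `t`,
i.e. `i ↦ I_α (R_α^i t)`. -/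
def sturmianSeqN (α t : ℝ) : ℕ → Bool := fun i => sturmianCode α (t + i * α)

/-- The one-sided Sturmian subshift `X_α`. -/
def sturmianN (α : ℝ) : Set (ℕ → Bool) := closure {x | ∃ t : ℝ, x = sturmianSeqN α t}

/-- The two-sided Sturmian sequence with parameter `α` and starting point `t`. -/
def sturmianSeqZ (α t : ℝ) : ℤ → Bool := fun i => sturmianCode α (t + i * α)

/-- The two-sided Sturmian subshift `Λ_α`. -/
def sturmianZ (α : ℝ) : Set (ℤ → Bool) := closure {x | ∃ t : ℝ, x = sturmianSeqZ α t}

/-- The shift on one-sided sequences. -/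
def shiftN {A : Type*} (x : ℕ → A) : ℕ → A := fun i => x (i + 1)

/-- The shift on two-sided sequences. -/
def shiftZ {A : Type*} (x : ℤ → A) : ℤ → A := fun i => x (i + 1)

lemma continuous_shiftN {A : Type*} [TopologicalSpace A] :
    Continuous (shiftN (A := A)) := continuous_pi fun i => continuous_apply (i + 1)

lemma continuous_shiftZ {A : Type*} [TopologicalSpace A] :
    Continuous (shiftZ (A := A)) := continuous_pi fun i => continuous_apply (i + 1)

lemma sturmianN_shift_mem {α : ℝ} {x : ℕ → Bool} (hx : x ∈ sturmianN α) :
    shiftN x ∈ sturmianN α := by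
  have h : MapsTo shiftN {x : ℕ → Bool | ∃ t : ℝ, x = sturmianSeqN α t}
      {x : ℕ → Bool | ∃ t : ℝ, x = sturmianSeqN α t} := by
    rintro x ⟨t, rfl⟩
    refine ⟨t + α, ?_⟩
    funext i
    show sturmianCode α (t + (↑(i + 1) : ℝ) * α) = sturmianCode α (t + α + (i : ℝ) * α)
    congr 1
    push_cast
    ring
  exact h.closure continuous_shiftN hx

lemma sturmianZ_shift_mem {α : ℝ} {x : ℤ → Bool} (hx : x ∈ sturmianZ α) :
    shiftZ x ∈ sturmianZ α := by
  have h : MapsTo shiftZ {x : ℤ → Bool | ∃ t : ℝ, x = sturmianSeqZ α t}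
      {x : ℤ → Bool | ∃ t : ℝ, x = sturmianSeqZ α t} := by
    rintro x ⟨t, rfl⟩
    refine ⟨t + α, ?_⟩
    funext i
    show sturmianCode α (t + (↑(i + 1) : ℝ) * α) = sturmianCode α (t + α + (i : ℝ) * α)
    congr 1
    push_cast
    ring
  exact h.closure continuous_shiftZ hx

/-- The shift map `σ_α : X_α → X_α` of the one-sided Sturmian subshift. -/
def sturmianShiftN (α : ℝ) (x : ↥(sturmianN α)) : ↥(sturmianN α) :=
  ⟨shiftN x.1, sturmianN_shift_mem x.2⟩

/-- The shift map `σ_α : Λ_α → Λ_α` of the two-sided Sturmian subshift. -/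
def sturmianShiftZ (α : ℝ) (x : ↥(sturmianZ α)) : ↥(sturmianZ α) :=
  ⟨shiftZ x.1, sturmianZ_shift_mem x.2⟩

/-- The branch point `ω_α` of the one-sided Sturmian subshift (corresponding to `t = α`). -/
def sturmianBranch (α : ℝ) : ℕ → Bool := sturmianSeqN α α

/-- The orbit `orb_α(x) = ⋃_{k,l} σ_α^{-l}(σ_α^k(x))` of a point of `X_α`. -/
def sturmianOrbN (α : ℝ) (x : ℕ → Bool) : Set (ℕ → Bool) :=
  {y | y ∈ sturmianN α ∧ ∃ k l : ℕ, shiftN^[l] y = shiftN^[k] x}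

/-- The forward orbit `orb⁺_α(x) = {σ_α^k(x) : k ∈ ℕ}`. -/
def sturmianOrbPlus (α : ℝ) (x : ℕ → Bool) : Set (ℕ → Bool) :=
  {y | ∃ k : ℕ, y = shiftN^[k] x}

/-- The orbit `{σ^n(x) : n ∈ ℤ}` of a two-sided sequence under the shift:
`σ^n(x) = (i ↦ x (i + n))`. -/
def orbitZ {A : Type*} (x : ℤ → A) : Set (ℤ → A) := {y | ∃ n : ℤ, y = fun i => x (i + n)}

/-- Equivalence of irrationals: `α ∼ β` iff `β = (aα+b)/(cα+d)` with `ad - bc = ±1`. -/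
def IrrationalEquiv (α β : ℝ) : Prop :=
  ∃ a b c d : ℤ, (a * d - b * c = 1 ∨ a * d - b * c = -1) ∧
    β = ((a : ℝ) * α + b) / ((c : ℝ) * α + d)

/-- The subgroup `ℤ + αℤ = {m + nα : m, n ∈ ℤ}` of `ℝ`, as an ordered abelian group with
the order inherited from `ℝ`. -/
def ZplusAZ (α : ℝ) : AddSubgroup ℝ where
  carrier := {x | ∃ m n : ℤ, x = (m : ℝ) + n * α}
  add_mem' := by
    rintro x y ⟨m, n, rfl⟩ ⟨m', n', rfl⟩
    exact ⟨m + m', n + n', by push_cast; ring⟩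
  zero_mem' := ⟨0, 0, by norm_num⟩
  neg_mem' := by
    rintro x ⟨m, n, rfl⟩
    exact ⟨-m, -n, by push_cast; ring⟩

lemma one_mem_ZplusAZ (α : ℝ) : (1 : ℝ) ∈ ZplusAZ α := ⟨1, 0, by norm_num⟩

/-! ### Suspension and flow -/

/-- The relation `(x, s+1) ∼ (σ_α x, s)` generating the suspension of `(Λ_α, σ_α)`. -/
def suspRel (α : ℝ) (p q : ↥(sturmianZ α) × ℝ) : Prop :=
  ∃ (x : ↥(sturmianZ α)) (s : ℝ), p = (x, s + 1) ∧ q = (sturmianShiftZ α x, s)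

/-- The suspension (mapping torus) of the two-sided Sturmian subshift `(Λ_α, σ_α)`:
the quotient of `Λ_α × ℝ` by the equivalence relation generated by `(x,s+1) ∼ (σ_α x, s)`. -/
def Suspension (α : ℝ) : Type := Quot (suspRel α)

instance (α : ℝ) : TopologicalSpace (Suspension α) := by
  unfold Suspension; infer_instance

/-- The flow `φ_{s'}[x,s] = [x, s + s']` on the suspension. -/
def suspFlow (α : ℝ) (s' : ℝ) : Suspension α → Suspension α :=
  Quot.map (fun p => (p.1, p.2 + s'))
    (by
      rintro p q ⟨x, s, rfl, rfl⟩
      exact ⟨x, s + s', by show (x, s + 1 + s') = (x, s + s' + 1); rw [add_right_comm s 1 s'], rfl⟩)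

/-- Flow equivalence of two Sturmian subshifts: a homeomorphism of the suspensions mapping
each flow orbit onto a flow orbit, preserving the forward direction of the flow. -/
def SturmianFlowEquiv (α β : ℝ) : Prop :=
  ∃ h : Suspension α ≃ₜ Suspension β, ∀ u : Suspension α, ∃ c : ℝ → ℝ,
    StrictMono c ∧ Function.Surjective c ∧
      ∀ s : ℝ, h (suspFlow α s u) = suspFlow β (c s) (h u)

/-! ### Words and pasts -/

/-- Prepend a letter to a one-sided sequence. -/
def consSeq {A : Type*} (a : A) (x : ℕ → A) : ℕ → A := fun i => if i = 0 then a else x (i - 1)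

/-- Prepend a finite word (a list) to a one-sided sequence: `μx`. -/
def wordCat {A : Type*} (μ : List A) (x : ℕ → A) : ℕ → A := μ.foldr consSeq x

/-- The set `P_l(x)` of `l`-pasts of `x` relative to a subshift `X`. -/
def past {A : Type*} (X : Set (ℕ → A)) (l : ℕ) (x : ℕ → A) : Set (List A) :=
  {μ | μ.length = l ∧ wordCat μ x ∈ X}

/-- `x` is isolated in `l`-past equivalence in `X`. -/
def IsolatedInPast {A : Type*} (X : Set (ℕ → A)) (l : ℕ) (x : ℕ → A) : Prop :=
  ∀ y ∈ X, past X l y = past X l x → y = x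


lemma shiftN_consSeq {A : Type*} (a : A) (x : ℕ → A) : shiftN (consSeq a x) = x := by
  funext i; simp [shiftN, consSeq]

lemma consSeq_shiftN {A : Type*} (x : ℕ → A) : consSeq (x 0) (shiftN x) = x := by
  funext i; cases i <;> simp [consSeq, shiftN]

lemma shiftN_iterate_apply {A : Type*} (x : ℕ → A) (k i : ℕ) : shiftN^[k] x i = x (i + k) := by
  induction k generalizing x i with
  | zero => rfl
  | succ k ih =>
    rw [Function.iterate_succ_apply, ih (shiftN x) i]
    show x (i + k + 1) = x (i + (k + 1))
    ring_nf

lemma shiftN_iterate_wordCat {A : Type*} (μ : List A) (x : ℕ → A) :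
    shiftN^[μ.length] (wordCat μ x) = x := by
  induction μ with
  | nil => rfl
  | cons a μ ih =>
    show shiftN^[μ.length + 1] (consSeq a (wordCat μ x)) = x
    rw [Function.iterate_succ_apply, shiftN_consSeq, ih]

lemma wordCat_append {A : Type*} (μ ν : List A) (x : ℕ → A) :
    wordCat (μ ++ ν) x = wordCat μ (wordCat ν x) := by
  simp [wordCat, List.foldr_append]

lemma shiftN_mem_of_image {A : Type*} {X : Set (ℕ → A)} (hX : shiftN '' X = X)
    {x : ℕ → A} (hx : x ∈ X) : shiftN x ∈ X := by
  rw [← hX]; exact ⟨x, hx, rfl⟩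

lemma shiftN_iterate_mem_of_image {A : Type*} {X : Set (ℕ → A)} (hX : shiftN '' X = X)
    {x : ℕ → A} (hx : x ∈ X) (k : ℕ) : shiftN^[k] x ∈ X := by
  induction k generalizing x with
  | zero => exact hx
  | succ k ih =>
    rw [Function.iterate_succ_apply]
    exact ih (shiftN_mem_of_image hX hx)

lemma exists_word_extension {A : Type*} {X : Set (ℕ → A)} (hX : shiftN '' X = X)
    {z : ℕ → A} (hz : z ∈ X) (d : ℕ) : ∃ ν : List A, ν.length = d ∧ wordCat ν z ∈ X := by
  induction d with
  | zero => exact ⟨[], rfl, hz⟩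
  | succ d ih =>
    obtain ⟨ν, hlen, hν⟩ := ih
    have : wordCat ν z ∈ shiftN '' X := by rw [hX]; exact hν
    obtain ⟨w, hw, hweq⟩ := this
    refine ⟨w 0 :: ν, by simp [hlen], ?_⟩
    show consSeq (w 0) (wordCat ν z) ∈ X
    rw [← hweq, consSeq_shiftN]
    exact hw

lemma past_mono {A : Type*} {X : Set (ℕ → A)} (hX : shiftN '' X = X) {m l : ℕ} (hml : m ≤ l)
    {z z' : ℕ → A} (h : past X l z = past X l z') : past X m z = past X m z' := by
  have key : ∀ w w' : ℕ → A, past X l w ⊆ past X l w' → past X m w ⊆ past X m w' := by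
    intro w w' hsub μ hμ
    obtain ⟨hlen, hmem⟩ := hμ
    obtain ⟨ν, hνlen, hνmem⟩ := exists_word_extension hX hmem (l - m)
    rw [← wordCat_append] at hνmem
    have hin : ν ++ μ ∈ past X l w := ⟨by simp [hνlen, hlen]; omega, hνmem⟩
    have hout := hsub hin
    obtain ⟨-, hmem'⟩ := hout
    rw [wordCat_append] at hmem'
    have := shiftN_iterate_mem_of_image hX hmem' ν.length
    rw [shiftN_iterate_wordCat] at this
    exact ⟨hlen, this⟩
  exact subset_antisymm (key z z' h.subset) (key z' z h.symm.subset)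

/-- prefix word of length `d` -/
def prefixWord {A : Type*} (x : ℕ → A) (d : ℕ) : List A := (List.range d).map x

lemma wordCat_prefixWord {A : Type*} (x : ℕ → A) (d : ℕ) :
    wordCat (prefixWord x d) (shiftN^[d] x) = x := by
  induction d generalizing x with
  | zero => rfl
  | succ d ih =>
    have h1 : prefixWord x (d + 1) = x 0 :: prefixWord (shiftN x) d := by
      show (List.range (d+1)).map x = _
      rw [List.range_succ_eq_map, List.map_cons, List.map_map]
      rfl
    rw [h1, Function.iterate_succ_apply]
    show consSeq (x 0) (wordCat (prefixWord (shiftN x) d) (shiftN^[d] (shiftN x))) = x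
    rw [ih (shiftN x), consSeq_shiftN]

lemma prefixWord_length {A : Type*} (x : ℕ → A) (d : ℕ) : (prefixWord x d).length = d := by
  simp [prefixWord]

lemma past_wordCat {A : Type*} {X : Set (ℕ → A)} (τ : List A) (z : ℕ → A) (m : ℕ) (μ : List A) :
    μ ∈ past X m (wordCat τ z) ↔ μ ++ τ ∈ past X (m + τ.length) z := by
  constructor
  · rintro ⟨hlen, hmem⟩
    exact ⟨by simp [hlen], by rwa [wordCat_append]⟩
  · rintro ⟨hlen, hmem⟩
    rw [wordCat_append] at hmem
    refine ⟨?_, hmem⟩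
    simp at hlen; omega

/-- Monotonicity of `∼_{k,l}` under the order `⪯`. -/
lemma sim_mono {A : Type*} {X : Set (ℕ → A)} (hX : shiftN '' X = X)
    {k₁ l₁ k₂ l₂ : ℕ} (hk : k₁ ≤ k₂) (hl : l₁ - k₁ ≤ l₂ - k₂) (hkl₁ : k₁ ≤ l₁) (hkl₂ : k₂ ≤ l₂)
    {x y : ℕ → A}
    (h1 : ∀ i < k₂, x i = y i)
    (h2 : past X l₂ (shiftN^[k₂] x) = past X l₂ (shiftN^[k₂] y)) :
    (∀ i < k₁, x i = y i) ∧ past X l₁ (shiftN^[k₁] x) = past X l₁ (shiftN^[k₁] y) := by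
  refine ⟨fun i hi => h1 i (lt_of_lt_of_le hi hk), ?_⟩
  set d := k₂ - k₁ with hd
  have hx : shiftN^[k₁] x = wordCat (prefixWord (shiftN^[k₁] x) d) (shiftN^[k₂] x) := by
    have := wordCat_prefixWord (shiftN^[k₁] x) d
    rw [← Function.iterate_add_apply, show d + k₁ = k₂ by omega] at this
    exact this.symm
  have hy : shiftN^[k₁] y = wordCat (prefixWord (shiftN^[k₁] y) d) (shiftN^[k₂] y) := by
    have := wordCat_prefixWord (shiftN^[k₁] y) d
    rw [← Function.iterate_add_apply, show d + k₁ = k₂ by omega] at this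
    exact this.symm
  have hτ : prefixWord (shiftN^[k₁] x) d = prefixWord (shiftN^[k₁] y) d := by
    unfold prefixWord
    refine List.map_congr_left ?_
    intro j hj
    rw [List.mem_range] at hj
    rw [shiftN_iterate_apply, shiftN_iterate_apply]
    exact h1 (j + k₁) (by omega)
  have hpast : past X (l₁ + d) (shiftN^[k₂] x) = past X (l₁ + d) (shiftN^[k₂] y) :=
    past_mono hX (by omega) h2
  ext μ
  rw [hx, hy, ← hτ, past_wordCat, past_wordCat, prefixWord_length, hpast]

/-- The Sturmian subshift is invariant: `σ(X_α) = X_α`. -/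
lemma sturmianN_shift_image (α : ℝ) : shiftN '' sturmianN α = sturmianN α := by
  apply subset_antisymm
  · rintro y ⟨x, hx, rfl⟩
    exact sturmianN_shift_mem hx
  · have hcompact : IsCompact (sturmianN α) := isClosed_closure.isCompact
    have hcl : IsClosed (shiftN '' sturmianN α) :=
      (hcompact.image continuous_shiftN).isClosed
    have hsub : {x : ℕ → Bool | ∃ t : ℝ, x = sturmianSeqN α t} ⊆ shiftN '' sturmianN α := by
      rintro x ⟨t, rfl⟩
      refine ⟨sturmianSeqN α (t - α), subset_closure ⟨t - α, rfl⟩, ?_⟩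
      funext i
      show sturmianCode α (t - α + (↑(i + 1) : ℝ) * α) = sturmianCode α (t + (i : ℝ) * α)
      congr 1
      push_cast
      ring
    exact closure_minimal hsub hcl

/-! ### The cover of a one-sided subshift -/

/-- The equivalence relation `∼_{k,l}` on a subshift `X`:
`x ∼_{k,l} x'` iff `x_{[0,k)} = x'_{[0,k)}` and `P_l(σ^k x) = P_l(σ^k x')`. -/
def coverSetoid {A : Type*} (X : Set (ℕ → A)) (k l : ℕ) : Setoid ↥X where
  r x y := (∀ i < k, x.1 i = y.1 i) ∧
    past X l (shiftN^[k] x.1) = past X l (shiftN^[k] y.1)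
  iseqv := ⟨fun _ => ⟨fun _ _ => rfl, rfl⟩,
    fun h => ⟨fun i hi => (h.1 i hi).symm, h.2.symm⟩,
    fun h h' => ⟨fun i hi => (h.1 i hi).trans (h'.1 i hi), h.2.trans h'.2⟩⟩

/-- The index set `I = {(k,l) ∈ ℕ × ℕ : k ≤ l}`. -/
def CoverIdx : Type := {p : ℕ × ℕ // p.1 ≤ p.2}

/-- The partial order `⪯` on the index set: `(k₁,l₁) ⪯ (k₂,l₂)` iff `k₁ ≤ k₂` and
`l₁ - k₁ ≤ l₂ - k₂`. -/
def CoverIdx.le (p q : CoverIdx) : Prop :=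
  p.1.1 ≤ q.1.1 ∧ p.1.2 - p.1.1 ≤ q.1.2 - q.1.1

/-- The cover `X̃` of a one-sided subshift `X`: the projective limit of the finite
quotients `X/∼_{k,l}` over the directed set `I`, realised as the set of coherent families
of equivalence classes.  A family is coherent if any representative at an index `q` is also
a representative at every index `p ⪯ q`. -/
def SubshiftCover {A : Type*} (X : Set (ℕ → A)) : Type _ :=
  {f : (p : CoverIdx) → Quotient (coverSetoid X p.1.1 p.1.2) //
    ∀ p q : CoverIdx, CoverIdx.le p q → ∀ x : ↥X,
      f q = Quotient.mk (coverSetoid X q.1.1 q.1.2) x →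
      f p = Quotient.mk (coverSetoid X p.1.1 p.1.2) x}

instance {A : Type*} [TopologicalSpace A] (X : Set (ℕ → A)) :
    TopologicalSpace (SubshiftCover X) := by
  unfold SubshiftCover; infer_instance

/-- The factor map `π : X̃ → X` (with values in the ambient space `A^ℕ`): the `n`-th letter
of `π(xt)` is the `n`-th letter of any `(n+1, n+1)`-representative of `xt`. -/
def coverProj {A : Type*} {X : Set (ℕ → A)} (f : SubshiftCover X) : ℕ → A := fun n =>
  Quotient.lift (fun x : ↥X => x.1 n)
    (by intro a b h; obtain ⟨h1, -⟩ := h; exact h1 n (Nat.lt_succ_self n))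
    (f.1 ⟨(n + 1, n + 1), le_refl _⟩)

/-- The shift `σ̃ : X̃ → X̃` induced on the cover: the `(k,l)`-coordinate of `σ̃(xt)` is the
class of `σ(x)` for a `(k+1, l+1)`-representative `x` of `xt`. -/
def coverShift {A : Type*} {X : Set (ℕ → A)} (hX : shiftN '' X = X)
    (f : SubshiftCover X) : SubshiftCover X :=
  ⟨fun p => Quotient.lift
      (fun x : ↥X => Quotient.mk (coverSetoid X p.1.1 p.1.2)
        ⟨shiftN x.1, shiftN_mem_of_image hX x.2⟩)
      (by
        intro a b h
        obtain ⟨h1, h2⟩ := h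
        apply Quotient.sound
        constructor
        · intro i hi
          exact h1 (i + 1) (Nat.succ_lt_succ hi)
        · show past X p.1.2 (shiftN^[p.1.1] (shiftN a.1)) =
            past X p.1.2 (shiftN^[p.1.1] (shiftN b.1))
          rw [← Function.iterate_succ_apply, ← Function.iterate_succ_apply]
          exact past_mono hX (Nat.le_succ p.1.2) h2)
      (f.1 ⟨(p.1.1 + 1, p.1.2 + 1), Nat.succ_le_succ p.2⟩),
    by
      intro p q hpq y hy
      obtain ⟨x, hx⟩ := Quotient.exists_rep (f.1 ⟨(q.1.1 + 1, q.1.2 + 1), Nat.succ_le_succ q.2⟩)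
      have hq' : f.1 ⟨(p.1.1 + 1, p.1.2 + 1), Nat.succ_le_succ p.2⟩ =
          Quotient.mk (coverSetoid X (p.1.1 + 1) (p.1.2 + 1)) x := by
        refine f.2 _ ⟨(q.1.1 + 1, q.1.2 + 1), Nat.succ_le_succ q.2⟩ ?_ x hx.symm
        refine ⟨Nat.succ_le_succ hpq.1, ?_⟩
        show p.1.2 + 1 - (p.1.1 + 1) ≤ q.1.2 + 1 - (q.1.1 + 1)
        have := hpq.2; omega
      beta_reduce at hy ⊢
      rw [← hx] at hy
      rw [hq']
      obtain ⟨h1, h2⟩ := Quotient.exact hy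
      exact Quotient.sound (sim_mono hX hpq.1 hpq.2 p.2 q.2 h1 h2)⟩

/-- The section `ι : X → X̃`, sending `x` to the family of its own classes. -/
def coverIota {A : Type*} {X : Set (ℕ → A)} (hX : shiftN '' X = X) (x : ↥X) :
    SubshiftCover X :=
  ⟨fun p => Quotient.mk (coverSetoid X p.1.1 p.1.2) x, by
    intro p q hpq y hy
    obtain ⟨h1, h2⟩ := Quotient.exact hy
    exact Quotient.sound (sim_mono hX hpq.1 hpq.2 p.2 q.2 h1 h2)⟩


/-! ### Rotations and codings -/

lemma sturmianCode_eq_floor {α : ℝ} (hα : α ∈ Ioo (0 : ℝ) 1) (t : ℝ) :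
    (if sturmianCode α t then 1 else 0 : ℤ) = ⌊t + α⌋ - ⌊t⌋ := by
  have h0 := Int.fract_nonneg t
  have h1 := Int.fract_lt_one t
  have h2 := Int.floor_add_fract t
  obtain ⟨ha, hb⟩ := hα
  unfold sturmianCode
  by_cases h : 1 - α ≤ Int.fract t
  · have : ⌊t + α⌋ = ⌊t⌋ + 1 := by
      rw [Int.floor_eq_iff]; push_cast; constructor <;> linarith
    simp [h, this]
  · have : ⌊t + α⌋ = ⌊t⌋ := by
      rw [Int.floor_eq_iff]; constructor <;> linarith
    simp [h, this]

/-- The number of symbols `1` among the first `n` letters of a sequence. -/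
def prefixWeight (n : ℕ) (y : ℕ → Bool) : ℤ := ∑ i ∈ Finset.range n, if y i then 1 else 0

lemma prefixWeight_succ (n : ℕ) (y : ℕ → Bool) :
    prefixWeight (n + 1) y = prefixWeight n y + if y n then 1 else 0 :=
  Finset.sum_range_succ _ _

lemma prefixWeight_add (m n : ℕ) (y : ℕ → Bool) :
    prefixWeight (m + n) y = prefixWeight m y + prefixWeight n (shiftN^[m] y) := by
  unfold prefixWeight
  rw [Finset.sum_range_add]
  simp only [shiftN_iterate_apply, add_comm]

lemma continuous_prefixWeight (n : ℕ) : Continuous (prefixWeight n) :=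
  continuous_finsetSum _ fun i _ =>
    (continuous_of_discreteTopology (f := fun b : Bool => if b then (1 : ℤ) else 0)).comp
      (continuous_apply i)

lemma prefixWeight_sturmianSeqN {α : ℝ} (hα : α ∈ Ioo (0 : ℝ) 1) (n : ℕ) (t : ℝ) :
    prefixWeight n (sturmianSeqN α t) = ⌊t + n * α⌋ - ⌊t⌋ := by
  induction n with
  | zero => simp [prefixWeight]
  | succ n ih =>
    rw [prefixWeight_succ, ih]
    unfold sturmianSeqN
    rw [sturmianCode_eq_floor hα]
    push_cast
    rw [show t + n * α + α = t + (n + 1) * α by ring]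
    ring

lemma sturmianSeqN_mem (α t : ℝ) : sturmianSeqN α t ∈ sturmianN α := subset_closure ⟨t, rfl⟩

lemma sturmianSeqN_add_int (α t : ℝ) (p : ℤ) : sturmianSeqN α (t + p) = sturmianSeqN α t := by
  funext i
  simp only [sturmianSeqN, sturmianCode]
  rw [show t + p + i * α = t + i * α + p by ring, Int.fract_add_intCast]

lemma shiftN_iterate_sturmianSeqN (α t : ℝ) (n : ℕ) :
    shiftN^[n] (sturmianSeqN α t) = sturmianSeqN α (t + n * α) := by
  funext i
  rw [shiftN_iterate_apply]
  simp only [sturmianSeqN]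
  push_cast
  ring_nf

/-- The forward orbit of an irrational rotation enters every left neighbourhood of `0`. -/
lemma exists_nat_lt_fract_add_mul {α : ℝ} (hα : Irrational α) (u : ℝ) {d : ℝ} (hd : 0 < d) :
    ∃ n : ℕ, 1 - d < Int.fract (u + n * α) := by
  obtain ⟨N, hN⟩ := exists_nat_gt (1 / d)
  have hNpos : 0 < N := by
    have : (0 : ℝ) < N := (one_div_pos.2 hd).trans hN
    exact_mod_cast this
  obtain ⟨j, k, hk, -, hjk⟩ := Real.exists_int_int_abs_mul_sub_le α hNpos
  have hNd : 1 / ((N : ℝ) + 1) < d := by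
    rw [div_lt_comm₀ (by positivity) hd]; linarith
  lift k to ℕ using hk.le
  have hk' : k ≠ 0 := by rintro rfl; simp at hk
  set e : ℝ := k * α - j with he
  have hed : |e| < d := by
    have := hjk.trans_lt hNd
    simpa [he] using this
  have he0 : e ≠ 0 := by
    have := (hα.natCast_mul hk').ne_int j
    exact sub_ne_zero.2 this
  obtain ⟨n, M, h1, h2⟩ : ∃ (n : ℕ) (M : ℤ), (M : ℝ) - |e| ≤ u + n * e ∧ u + n * e < M := by
    rcases lt_or_gt_of_ne he0 with h | h
    · refine ⟨⌊Int.fract u / -e⌋₊ + 1, ⌊u⌋, ?_⟩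
      have hne : 0 < -e := by linarith
      have h3 := Nat.floor_le (div_nonneg (Int.fract_nonneg u) hne.le)
      have h4 := Nat.lt_floor_add_one (Int.fract u / -e)
      rw [le_div_iff₀ hne] at h3
      rw [div_lt_iff₀ hne] at h4
      have h5 := Int.floor_add_fract u
      rw [abs_of_neg h]
      push_cast
      constructor <;> linarith
    · obtain ⟨m, hm⟩ : ∃ m, ⌈(1 - Int.fract u) / e⌉₊ = m + 1 :=
        Nat.exists_eq_succ_of_ne_zero
          (Nat.ceil_pos.2 (div_pos (by linarith [Int.fract_lt_one u]) h)).ne'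
      refine ⟨m, ⌊u⌋ + 1, ?_⟩
      have h3 := Nat.le_ceil ((1 - Int.fract u) / e)
      have h4 : (m : ℝ) < (1 - Int.fract u) / e := Nat.lt_ceil.1 (by omega)
      rw [hm, div_le_iff₀ h] at h3
      rw [lt_div_iff₀ h] at h4
      have h5 := Int.floor_add_fract u
      rw [abs_of_pos h]
      push_cast at h3 ⊢
      constructor <;> linarith
  refine ⟨n * k, ?_⟩
  have h3 : u + ((n * k : ℕ) : ℝ) * α = u + n * e + ((n * j : ℤ) : ℝ) := by
    rw [he]; push_cast; ring
  rw [h3, Int.fract_add_intCast]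
  have h4 : ⌊u + n * e⌋ ≤ M - 1 := by
    have : ⌊u + n * e⌋ < M := Int.floor_lt.2 h2
    omega
  have h5 : (⌊u + n * e⌋ : ℝ) ≤ M - 1 := by exact_mod_cast h4
  have h6 := Int.floor_add_fract (u + n * e)
  linarith
/-- `t` is an angle of the sequence `y` if `y` codes, up to the choice of a one-sided limit,
the orbit of `t` under the rotation by `α`. -/
def IsAngle (α : ℝ) (y : ℕ → Bool) (t : ℝ) : Prop :=
  ∀ n : ℕ, t + n * α - 1 ≤ prefixWeight n y ∧ (prefixWeight n y : ℝ) ≤ t + n * α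

lemma IsAngle.mem_Icc {α : ℝ} {y : ℕ → Bool} {t : ℝ} (h : IsAngle α y t) :
    t ∈ Icc (0 : ℝ) 1 := by
  have := h 0
  simp only [prefixWeight, Finset.range_zero, Finset.sum_empty] at this
  push_cast at this
  constructor <;> linarith [this.1, this.2]

lemma isAngle_sturmianSeqN {α : ℝ} (hα : α ∈ Ioo (0 : ℝ) 1) (t : ℝ) :
    IsAngle α (sturmianSeqN α t) (Int.fract t) := by
  intro n
  rw [prefixWeight_sturmianSeqN hα]
  have h1 := Int.floor_add_fract t
  have h2 := Int.floor_le (t + n * α)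
  have h3 := Int.lt_floor_add_one (t + n * α)
  push_cast
  constructor <;> linarith

lemma exists_isAngle {α : ℝ} (hα : α ∈ Ioo (0 : ℝ) 1) {y : ℕ → Bool} (hy : y ∈ sturmianN α) :
    ∃ t, IsAngle α y t := by
  let K : Set ((ℕ → Bool) × Icc (0 : ℝ) 1) := {p | IsAngle α p.1 p.2}
  have hK : IsClosed K := by
    simp only [K, IsAngle, ofPred_forall, ofPred_and]
    have hw : ∀ n : ℕ, Continuous fun p : (ℕ → Bool) × Icc (0 : ℝ) 1 =>
        (prefixWeight n p.1 : ℝ) := fun n =>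
      continuous_of_discreteTopology.comp ((continuous_prefixWeight n).comp continuous_fst)
    refine isClosed_iInter fun n => IsClosed.inter ?_ ?_
    · exact isClosed_le (by fun_prop) (hw n)
    · exact isClosed_le (hw n) (by fun_prop)
  have hsub : sturmianN α ⊆ Prod.fst '' K := by
    refine closure_minimal ?_ (isClosedMap_fst_of_compactSpace _ hK)
    rintro _ ⟨t, rfl⟩
    have h := isAngle_sturmianSeqN hα t
    exact ⟨(_, ⟨_, h.mem_Icc⟩), h, rfl⟩
  obtain ⟨p, hp, rfl⟩ := hsub hy
  exact ⟨_, hp⟩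

lemma IsAngle.unique {α : ℝ} (hα : Irrational α) {y : ℕ → Bool} {s t : ℝ}
    (hs : IsAngle α y s) (ht : IsAngle α y t) : s = t := by
  suffices key : ∀ {s t}, IsAngle α y s → IsAngle α y t → ¬ s < t from
    le_antisymm (not_lt.1 (key ht hs)) (not_lt.1 (key hs ht))
  intro s t hs ht hst
  obtain ⟨n, hn⟩ := exists_nat_lt_fract_add_mul hα s (sub_pos.2 hst)
  have h1 : prefixWeight n y ≤ ⌊s + n * α⌋ := Int.le_floor.2 (hs n).2
  have h2 : (prefixWeight n y : ℝ) ≤ ⌊s + n * α⌋ := by exact_mod_cast h1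
  have h3 := (ht n).1
  have h4 := Int.floor_add_fract (s + n * α)
  linarith

lemma IsAngle.shiftN_iterate {α : ℝ} {y : ℕ → Bool} {t : ℝ} (h : IsAngle α y t) (m : ℕ) :
    IsAngle α (shiftN^[m] y) (t + m * α - prefixWeight m y) := by
  intro n
  have h1 := h (m + n)
  rw [prefixWeight_add] at h1
  push_cast at h1
  constructor <;> linarith [h1.1, h1.2]

lemma IsAngle.eq_sturmianSeqN {α : ℝ} (hα : α ∈ Ioo (0 : ℝ) 1) {y : ℕ → Bool} {t : ℝ}
    (h : IsAngle α y t) (ht : ∀ (n : ℕ) (p : ℤ), t + n * α ≠ p) : y = sturmianSeqN α t := by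
  have hw : ∀ n : ℕ, prefixWeight n y = ⌊t + n * α⌋ := by
    intro n
    symm
    rw [Int.floor_eq_iff]
    refine ⟨(h n).2, ?_⟩
    have h1 := (h n).1
    have h2 := ht n (prefixWeight n y + 1)
    push_cast at h2
    exact lt_of_le_of_ne (by linarith) h2
  funext n
  have h1 := prefixWeight_succ n y
  have h2 := sturmianCode_eq_floor hα (t + n * α)
  rw [hw, hw] at h1
  push_cast at h1
  rw [show t + n * α + α = t + (n + 1) * α by ring, h1] at h2
  simp only [add_sub_cancel_left] at h2
  unfold sturmianSeqN
  revert h2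
  cases y n <;> cases sturmianCode α (t + n * α) <;> simp

/-- `t` is generic for `α` if it does not lie in `ℤ + αℤ`. -/
def IsGeneric (α t : ℝ) : Prop := ∀ p q : ℤ, t ≠ p + q * α

lemma IsGeneric.add {α t : ℝ} (h : IsGeneric α t) (p q : ℤ) : IsGeneric α (t + p + q * α) := by
  intro p' q' h'
  apply h (p' - p) (q' - q)
  push_cast
  linarith

lemma IsAngle.eq_sturmianSeqN_of_isGeneric {α : ℝ} (hα : α ∈ Ioo (0 : ℝ) 1) {y : ℕ → Bool}
    {t : ℝ} (h : IsAngle α y t) (ht : IsGeneric α t) : y = sturmianSeqN α t := by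
  refine h.eq_sturmianSeqN hα fun n p hp => ht p (-n) ?_
  push_cast
  linarith

/-- A point of the subshift that is tail equivalent to the coding of a generic point `s` is the
coding of a point of the two-sided orbit of `s`. -/
lemma eq_sturmianSeqN_of_shiftN_iterate_eq {α : ℝ} (hα : Irrational α) (hαm : α ∈ Ioo (0 : ℝ) 1)
    {s : ℝ} (hs : IsGeneric α s) {y : ℕ → Bool} (hy : y ∈ sturmianN α) {a b : ℕ} {c : ℤ}
    (h : shiftN^[a] y = shiftN^[b] (sturmianSeqN α (s + c * α))) :
    y = sturmianSeqN α (s + (c + b - a : ℤ) * α) := by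
  obtain ⟨t, ht⟩ := exists_isAngle hαm hy
  have h1 := ht.shiftN_iterate a
  have h2 := (isAngle_sturmianSeqN hαm (s + c * α)).shiftN_iterate b
  rw [h] at h1
  have h3 := h1.unique hα h2
  have h4 := Int.floor_add_fract (s + c * α)
  obtain ⟨p, hp⟩ : ∃ p : ℤ, t = s + (c + b - a : ℤ) * α + p := by
    refine ⟨prefixWeight a y - ⌊s + c * α⌋
      - prefixWeight b (sturmianSeqN α (s + c * α)), ?_⟩
    push_cast
    linarith
  have hg : IsGeneric α t := by
    have := hs.add p (c + b - a)
    rwa [hp, add_right_comm]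
  rw [ht.eq_sturmianSeqN_of_isGeneric hαm hg, hp, sturmianSeqN_add_int]

lemma sturmianSeqN_orbit_injective {α : ℝ} (hα : Irrational α) (hαm : α ∈ Ioo (0 : ℝ) 1)
    (t : ℝ) : Function.Injective fun n : ℤ => sturmianSeqN α (t + n * α) := by
  intro m n h
  have h1 := isAngle_sturmianSeqN hαm (t + m * α)
  have h2 := isAngle_sturmianSeqN hαm (t + n * α)
  dsimp only at h
  rw [h] at h1
  obtain ⟨z, hz⟩ := Int.fract_eq_fract.1 (h1.unique hα h2)
  by_contra hmn
  have h3 := (hα.intCast_mul (sub_ne_zero.2 hmn)).ne_int z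
  push_cast at h3
  exact h3 (by linarith)

/-- The points of the subshift that are not codings of generic points are countably many. -/
lemma countable_isAngle_not_isGeneric {α : ℝ} (hα : Irrational α) (hαm : α ∈ Ioo (0 : ℝ) 1) :
    {y : ℕ → Bool | ∃ t, IsAngle α y t ∧ ¬ IsGeneric α t}.Countable := by
  refine (countable_range fun p : List Bool × ℤ =>
    wordCat p.1 (sturmianSeqN α (p.2 * α))).mono ?_
  rintro y ⟨t, ht, hg⟩
  simp only [IsGeneric, not_forall, not_not] at hg
  obtain ⟨p, q, rfl⟩ := hg
  set n := q.natAbs + 1 with hn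
  have h1 := ht.shiftN_iterate n
  obtain ⟨r, hr⟩ : ∃ r : ℤ, (p + q * α + n * α - prefixWeight n y : ℝ)
      = ((q + n : ℤ) : ℝ) * α + r := ⟨p - prefixWeight n y, by push_cast; ring⟩
  rw [hr] at h1
  have h2 := h1.eq_sturmianSeqN hαm fun m z hz => by
    have h0 : q + n + m ≠ 0 := by omega
    apply (hα.intCast_mul h0).ne_int (z - r)
    push_cast at hz ⊢
    linarith
  rw [sturmianSeqN_add_int] at h2
  exact ⟨(prefixWord y n, q + n), by dsimp only; rw [← h2, wordCat_prefixWord]⟩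
/-! ### Permutations of the integers with bounded steps -/

lemma abs_sub_le_mul_of_step {p : ℤ → ℤ} {D : ℤ} (hp : ∀ n, |p (n + 1) - p n| ≤ D) (a b : ℤ) :
    |p a - p b| ≤ D * |a - b| := by
  have key : ∀ (b : ℤ) (n : ℕ), |p (b + n) - p b| ≤ D * n := by
    intro b n
    induction n with
    | zero => simp
    | succ n ih =>
      have h1 := hp (b + n)
      push_cast
      rw [show b + ((n : ℤ) + 1) = b + n + 1 by ring]
      have h2 := abs_sub_le (p (b + n + 1)) (p (b + n)) (p b)
      linarith
  rcases le_total a b with h | h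
  · obtain ⟨n, rfl⟩ := Int.le.dest h
    simpa [abs_sub_comm] using key a n
  · obtain ⟨n, rfl⟩ := Int.le.dest h
    simpa using key b n

lemma lt_or_gt_of_step {f : ℤ → ℤ} {C q n₀ : ℤ} (hf : ∀ n, |f (n + 1) - f n| ≤ C)
    (hq : ∀ n, n₀ ≤ n → C < |f n - q|) :
    (∀ n, n₀ ≤ n → q < f n) ∨ (∀ n, n₀ ≤ n → f n < q) := by
  have h0 : 0 ≤ C := (abs_nonneg _).trans (hf 0)
  rcases lt_trichotomy q (f n₀) with h | h | h
  · refine Or.inl fun n hn => ?_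
    induction n, hn using Int.leInduction with
    | base => exact h
    | succ n hn ih =>
      have h1 := hq (n + 1) (by omega)
      have h2 := hq n hn
      have h3 := abs_le.1 (hf n)
      rw [abs_of_pos (by omega)] at h2
      omega
  · have := hq n₀ le_rfl
    rw [h, sub_self, abs_zero] at this
    omega
  · refine Or.inr fun n hn => ?_
    induction n, hn using Int.leInduction with
    | base => exact h
    | succ n hn ih =>
      have h1 := hq (n + 1) (by omega)
      have h2 := hq n hn
      have h3 := abs_le.1 (hf n)
      rw [abs_of_neg (by omega)] at h2
      omega

lemma abs_sub_id_le_of_eventually_lt {f p : ℤ → ℤ} {K : ℤ} (hK : 0 ≤ K)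
    (hpf : ∀ n, p (f n) = n) (hfp : ∀ n, f (p n) = n)
    (h : ∀ a n, a + K < n → f a < f n) (n : ℕ) : |f n - f 0 - n| ≤ 2 * K + 1 := by
  have hf : Function.Injective f := Function.LeftInverse.injective hpf
  have hp : Function.Injective p := Function.LeftInverse.injective hfp
  have h1 : (Finset.Ioo K (n - K)).card ≤ (Finset.Ioo (f 0) (f n)).card := by
    refine Finset.card_le_card_of_injOn f (fun j hj => ?_) hf.injOn
    simp only [Finset.coe_Ioo, mem_Ioo] at hj ⊢
    exact ⟨h 0 j (by omega), h j n (by omega)⟩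
  have h2 : (Finset.Ico (f 0) (f n)).card ≤ (Finset.Icc (-K) (n + K)).card := by
    refine Finset.card_le_card_of_injOn p (fun j hj => ?_) hp.injOn
    simp only [Finset.coe_Ico, mem_Ico, Finset.coe_Icc, mem_Icc] at hj ⊢
    constructor
    · by_contra hc
      have := h (p j) 0 (by omega)
      rw [hfp] at this
      omega
    · by_contra hc
      have := h n (p j) (by omega)
      rw [hfp] at this
      omega
  have h3 : (Finset.Ico (f n) (f 0)).card ≤ (Finset.Icc (n - K) K).card := by
    refine Finset.card_le_card_of_injOn p (fun j hj => ?_) hp.injOn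
    simp only [Finset.coe_Ico, mem_Ico, Finset.coe_Icc, mem_Icc] at hj ⊢
    constructor
    · by_contra hc
      have := h (p j) n (by omega)
      rw [hfp] at this
      omega
    · by_contra hc
      have := h 0 (p j) (by omega)
      rw [hfp] at this
      omega
  simp only [Int.card_Ioo, Int.card_Ico, Int.card_Icc] at h1 h2 h3
  rw [abs_le]
  constructor <;> omega

lemma eventually_lt_of_step {f p : ℤ → ℤ} {C D : ℤ} (hC : ∀ n, |f (n + 1) - f n| ≤ C)
    (hD : ∀ n, |p (n + 1) - p n| ≤ D) (hpf : ∀ n, p (f n) = n) :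
    (∀ a n, a + D * C < n → f a < f n) ∨ (∀ a n, a + D * C < n → f n < f a) := by
  have hD0 : 0 ≤ D := (abs_nonneg _).trans (hD 0)
  have key : ∀ a, (∀ n, a + D * C + 1 ≤ n → f a < f n) ∨
      (∀ n, a + D * C + 1 ≤ n → f n < f a) := by
    intro a
    refine lt_or_gt_of_step hC fun n hn => ?_
    by_contra! hc
    have h1 := abs_sub_le_mul_of_step hD (f n) (f a)
    rw [hpf, hpf] at h1
    have h2 := h1.trans (mul_le_mul_of_nonneg_left hc hD0)
    have h3 := le_abs_self (n - a)
    omega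
  have hcons : ∀ a b, (∀ n, a + D * C + 1 ≤ n → f a < f n) →
      ¬ ∀ n, b + D * C + 1 ≤ n → f n < f b := by
    intro a b ha hb
    have hf : Function.Injective f := Function.LeftInverse.injective hpf
    refine (Set.Ici_infinite (max (a + D * C + 1) (b + D * C + 1)))
      (((Set.finite_Ioo (f a) (f b)).preimage hf.injOn).subset fun n hn => ?_)
    rw [mem_Ici, max_le_iff] at hn
    exact ⟨ha n hn.1, hb n hn.2⟩
  rcases key 0 with h0 | h0
  · exact Or.inl fun a n hn => ((key a).resolve_right (hcons 0 a h0)) n (by omega)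
  · exact Or.inr fun a n hn => ((key a).resolve_left fun h => hcons a 0 h h0) n (by omega)

/-- A permutation of `ℤ` which, together with its inverse, has bounded steps stays at bounded
distance from a translation or a reflection. -/
lemma exists_abs_sub_mul_le {f p : ℤ → ℤ} {C D : ℤ} (hC : ∀ n, |f (n + 1) - f n| ≤ C)
    (hD : ∀ n, |p (n + 1) - p n| ≤ D) (hpf : ∀ n, p (f n) = n) (hfp : ∀ n, f (p n) = n) :
    ∃ ε K : ℤ, (ε = 1 ∨ ε = -1) ∧ ∀ n : ℕ, |f n - f 0 - ε * n| ≤ K := by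
  have hK : 0 ≤ D * C :=
    mul_nonneg ((abs_nonneg _).trans (hD 0)) ((abs_nonneg _).trans (hC 0))
  rcases eventually_lt_of_step hC hD hpf with h | h
  · refine ⟨1, 2 * (D * C) + 1, Or.inl rfl, fun n => ?_⟩
    rw [one_mul]
    exact abs_sub_id_le_of_eventually_lt hK hpf hfp h n
  · refine ⟨-1, 2 * (D * C) + 1, Or.inr rfl, fun n => ?_⟩
    have := abs_sub_id_le_of_eventually_lt (f := fun n => - f n) (p := fun n => p (-n)) hK
      (by simpa using hpf) (by simp [hfp]) (fun a n hn => neg_lt_neg (h a n hn)) n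
    rw [← abs_neg]
    convert this using 2
    ring
/-! ### Means of locally constant functions along orbits -/

/-- The indicator function of the arc `[0, -iα)` of the circle, expressed through the cocycle
`⌊t + iα⌋`. -/
def arcIndicator (α : ℝ) (i : ℕ) (t : ℝ) : ℤ := ⌊t⌋ - ⌊t + i * α⌋ - ⌊-(i * α)⌋

lemma arcIndicator_eq (α : ℝ) (i : ℕ) (t : ℝ) :
    arcIndicator α i t = if Int.fract t < Int.fract (-(i * α)) then 1 else 0 := by
  have h1 := Int.floor_add_fract t
  have h2 := Int.floor_add_fract (-(i * α))
  have h3 := Int.fract_nonneg t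
  have h4 := Int.fract_lt_one t
  have h5 := Int.fract_nonneg (-(i * α))
  have h6 := Int.fract_lt_one (-(i * α))
  unfold arcIndicator
  split_ifs with h
  · have : ⌊t + i * α⌋ = ⌊t⌋ - ⌊-(i * α)⌋ - 1 := by
      rw [Int.floor_eq_iff]; push_cast; constructor <;> linarith
    omega
  · have : ⌊t + i * α⌋ = ⌊t⌋ - ⌊-(i * α)⌋ := by
      rw [Int.floor_eq_iff]; push_cast; constructor <;> linarith
    omega

/-- The functions `1` and `arcIndicator α i` are the indicators of a chain of sets, hence form a
multiplicative monoid. -/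
def arcMonoid (α : ℝ) : Submonoid (ℝ → ℤ) where
  carrier := insert 1 (range (arcIndicator α))
  one_mem' := mem_insert _ _
  mul_mem' := by
    have key : ∀ i j : ℕ, Int.fract (-(i * α)) ≤ Int.fract (-(j * α)) →
        arcIndicator α i * arcIndicator α j = arcIndicator α i := by
      intro i j hij
      funext t
      rw [Pi.mul_apply, arcIndicator_eq, arcIndicator_eq]
      by_cases h : Int.fract t < Int.fract (-(i * α))
      · simp [h, h.trans_le hij]
      · simp [h]
    rintro f g (rfl | ⟨i, rfl⟩) hg
    · rwa [one_mul]
    · rcases hg with rfl | ⟨j, rfl⟩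
      · rw [mul_one]
        exact mem_insert_of_mem _ ⟨i, rfl⟩
      · rcases le_total (Int.fract (-(i * α))) (Int.fract (-(j * α))) with h | h
        · exact mem_insert_of_mem _ ⟨i, (key i j h).symm⟩
        · exact mem_insert_of_mem _ ⟨j, by rw [mul_comm, key j i h]⟩

/-- `u` has bounded discrepancy along the rotation by `α` with respect to the mean `θ`. -/
def HasBoundedDiscrepancy (α : ℝ) (u : ℝ → ℤ) (θ : ℝ) : Prop :=
  ∃ K : ℝ, ∀ (t : ℝ) (n : ℕ), |∑ j ∈ Finset.range n, (u (t + j * α) : ℝ) - n * θ| ≤ K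

lemma hasBoundedDiscrepancy_one (α : ℝ) : HasBoundedDiscrepancy α 1 1 :=
  ⟨0, fun t n => by simp⟩

lemma hasBoundedDiscrepancy_arcIndicator (α : ℝ) (i : ℕ) :
    HasBoundedDiscrepancy α (arcIndicator α i) (Int.fract (-(i * α))) := by
  have key : ∀ (i : ℕ) (t : ℝ) (n : ℕ), |∑ j ∈ Finset.range n,
      (Int.fract (t + j * α + i * α) - Int.fract (t + j * α))| ≤ i := by
    intro i t n
    induction i with
    | zero => simp
    | succ i ih =>
      have h1 : ∑ j ∈ Finset.range n, (Int.fract (t + j * α + (i + 1 : ℕ) * α)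
            - Int.fract (t + j * α + i * α))
          = Int.fract (t + n * α + i * α) - Int.fract (t + i * α) := by
        have := Finset.sum_range_sub (fun j : ℕ => Int.fract (t + j * α + i * α)) n
        simp only [Nat.cast_zero, zero_mul, add_zero] at this
        rw [← this]
        refine Finset.sum_congr rfl fun j _ => ?_
        push_cast
        rw [show t + (j : ℝ) * α + (i + 1) * α = t + (j + 1) * α + i * α by ring]
      have h2 : ∑ j ∈ Finset.range n, (Int.fract (t + j * α + (i + 1 : ℕ) * α)
            - Int.fract (t + j * α))
          = (Int.fract (t + n * α + i * α) - Int.fract (t + i * α)) + ∑ j ∈ Finset.range n,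
            (Int.fract (t + j * α + i * α) - Int.fract (t + j * α)) := by
        rw [← h1, ← Finset.sum_add_distrib]
        exact Finset.sum_congr rfl fun j _ => by ring
      rw [h2]
      push_cast
      have h3 : |Int.fract (t + n * α + i * α) - Int.fract (t + i * α)| ≤ 1 := by
        rw [abs_le]
        constructor <;> linarith [Int.fract_nonneg (t + n * α + i * α),
          Int.fract_lt_one (t + n * α + i * α), Int.fract_nonneg (t + i * α),
          Int.fract_lt_one (t + i * α)]
      linarith [abs_add_le (Int.fract (t + n * α + i * α) - Int.fract (t + i * α))
        (∑ j ∈ Finset.range n, (Int.fract (t + j * α + i * α) - Int.fract (t + j * α)))]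
  refine ⟨i, fun t n => ?_⟩
  convert key i t n using 2
  have h : ∀ j : ℕ, (arcIndicator α i (t + j * α) : ℝ)
      = (Int.fract (t + j * α + i * α) - Int.fract (t + j * α)) + Int.fract (-(i * α)) := by
    intro j
    unfold arcIndicator
    have h1 := Int.floor_add_fract (t + j * α)
    have h2 := Int.floor_add_fract (t + j * α + i * α)
    have h3 := Int.floor_add_fract (-(i * α))
    push_cast
    linarith
  simp only [h, Finset.sum_add_distrib, Finset.sum_const, Finset.card_range, nsmul_eq_mul]
  ring

lemma HasBoundedDiscrepancy.add {α θ θ' : ℝ} {u u' : ℝ → ℤ} (h : HasBoundedDiscrepancy α u θ)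
    (h' : HasBoundedDiscrepancy α u' θ') : HasBoundedDiscrepancy α (u + u') (θ + θ') := by
  obtain ⟨K, hK⟩ := h
  obtain ⟨K', hK'⟩ := h'
  refine ⟨K + K', fun t n => ?_⟩
  refine le_trans (le_of_eq ?_) ((abs_add_le _ _).trans (add_le_add (hK t n) (hK' t n)))
  simp only [Pi.add_apply, Int.cast_add, Finset.sum_add_distrib]
  congr 1
  ring

lemma HasBoundedDiscrepancy.neg {α θ : ℝ} {u : ℝ → ℤ} (h : HasBoundedDiscrepancy α u θ) :
    HasBoundedDiscrepancy α (-u) (-θ) := by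
  obtain ⟨K, hK⟩ := h
  refine ⟨K, fun t n => ?_⟩
  rw [← abs_neg]
  convert hK t n using 2
  simp only [Pi.neg_apply, Int.cast_neg, Finset.sum_neg_distrib]
  ring

lemma exists_hasBoundedDiscrepancy {α : ℝ} {u : ℝ → ℤ}
    (hu : u ∈ Subring.closure (arcMonoid α : Set (ℝ → ℤ))) :
    ∃ θ ∈ ZplusAZ α, HasBoundedDiscrepancy α u θ := by
  rw [Subring.mem_closure_iff, Submonoid.closure_eq] at hu
  induction hu using AddSubgroup.closure_induction with
  | mem u hu =>
    rcases hu with rfl | ⟨i, rfl⟩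
    · exact ⟨1, one_mem_ZplusAZ α, hasBoundedDiscrepancy_one α⟩
    · refine ⟨_, ⟨-⌊-(i * α)⌋, -i, ?_⟩, hasBoundedDiscrepancy_arcIndicator α i⟩
      have := Int.floor_add_fract (-(i * α))
      push_cast
      linarith
  | zero => exact ⟨0, zero_mem _, 0, fun t n => by simp⟩
  | add u u' _ _ h h' =>
    obtain ⟨θ, hθ, h⟩ := h
    obtain ⟨θ', hθ', h'⟩ := h'
    exact ⟨_, add_mem hθ hθ', h.add h'⟩
  | neg u _ h =>
    obtain ⟨θ, hθ, h⟩ := h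
    exact ⟨_, neg_mem hθ, h.neg⟩

lemma sturmianSeqN_letter_mem_closure {α : ℝ} (hα : α ∈ Ioo (0 : ℝ) 1) (i : ℕ) :
    (fun t => if sturmianSeqN α t i then (1 : ℤ) else 0)
      ∈ Subring.closure (arcMonoid α : Set (ℝ → ℤ)) := by
  have h : (fun t => if sturmianSeqN α t i then (1 : ℤ) else 0)
      = arcIndicator α i - arcIndicator α (i + 1)
        + ((⌊-(i * α)⌋ - ⌊-((i + 1 : ℕ) * α)⌋ : ℤ) : ℝ → ℤ) := by
    funext t
    have := sturmianCode_eq_floor hα (t + i * α)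
    change (if sturmianCode α (t + i * α) then (1 : ℤ) else 0) = arcIndicator α i t
      - arcIndicator α (i + 1) t + (⌊-(i * α)⌋ - ⌊-((i + 1 : ℕ) * α)⌋)
    rw [this]
    unfold arcIndicator
    push_cast
    rw [show t + i * α + α = t + (i + 1) * α by ring]
    ring
  rw [h]
  have hmem : ∀ j, arcIndicator α j ∈ Subring.closure (arcMonoid α : Set (ℝ → ℤ)) := fun j =>
    Subring.subset_closure (mem_insert_of_mem _ ⟨j, rfl⟩)
  exact add_mem (sub_mem (hmem _) (hmem _)) (intCast_mem _ _)

lemma comp_prefix_mem_closure {α : ℝ} (hα : α ∈ Ioo (0 : ℝ) 1) {N : ℕ}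
    (Φ : (Fin N → Bool) → ℤ) :
    (fun t => Φ fun i => sturmianSeqN α t i) ∈ Subring.closure (arcMonoid α : Set (ℝ → ℤ)) := by
  classical
  have hb : ∀ (i : Fin N) (b : Bool), (fun t => if sturmianSeqN α t i = b then (1 : ℤ) else 0)
      ∈ Subring.closure (arcMonoid α : Set (ℝ → ℤ)) := by
    intro i b
    have h := sturmianSeqN_letter_mem_closure hα i
    cases b
    · convert sub_mem (one_mem _) h using 1
      funext t
      cases hx : sturmianSeqN α t i <;> simp [hx]
    · exact h
  have h : (fun t => Φ fun i => sturmianSeqN α t i)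
      = ∑ w : Fin N → Bool, (Φ w : ℝ → ℤ) *
        ∏ i : Fin N, fun t => if sturmianSeqN α t i = w i then (1 : ℤ) else 0 := by
    funext t
    simp only [Finset.sum_apply, Pi.mul_apply, Finset.prod_apply, Pi.intCast_apply,
      Finset.prod_ite_zero, Finset.prod_const_one, Finset.mem_univ, true_implies, mul_ite,
      mul_one, mul_zero, Int.cast_id]
    rw [Finset.sum_eq_single fun i : Fin N => sturmianSeqN α t i]
    · simp
    · intro w _ hw
      exact if_neg fun h => hw (funext fun i => (h i).symm)
    · simp
  rw [h]
  exact sum_mem fun w _ => mul_mem (intCast_mem _ _) (prod_mem fun i _ => hb i _)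

/-- A continuous map from a compact set of sequences to a discrete space depends only on a prefix
of bounded length. -/
lemma exists_forall_prefix_eq {X : Set (ℕ → Bool)} (hX : IsCompact X) {u : ↥X → ℤ}
    (hu : Continuous u) : ∃ N : ℕ, ∀ x y : ↥X, (∀ i < N, x.1 i = y.1 i) → u x = u y := by
  have := isCompact_iff_compactSpace.1 hX
  have hK : IsCompact {p : ↥X × ↥X | u p.1 ≠ u p.2} := by
    refine IsClosed.isCompact ?_
    exact (isClosed_discrete {q : ℤ × ℤ | q.1 ≠ q.2}).preimage
      ((hu.comp continuous_fst).prodMk (hu.comp continuous_snd))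
  let U : ℕ → Set (↥X × ↥X) := fun N => {p | ∃ i < N, p.1.1 i ≠ p.2.1 i}
  have hUopen : ∀ N, IsOpen (U N) := by
    intro N
    simp only [U, ofPred_exists, ofPred_and]
    refine isOpen_iUnion fun i => IsOpen.inter isOpen_const ?_
    have h1 : Continuous fun p : ↥X × ↥X => p.1.1 i :=
      (continuous_apply i).comp (continuous_subtype_val.comp continuous_fst)
    have h2 : Continuous fun p : ↥X × ↥X => p.2.1 i :=
      (continuous_apply i).comp (continuous_subtype_val.comp continuous_snd)
    exact isOpen_ne_fun h1 h2
  have hUcover : {p : ↥X × ↥X | u p.1 ≠ u p.2} ⊆ ⋃ N, U N := by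
    rintro ⟨x, y⟩ hxy
    have : x.1 ≠ y.1 := fun h => hxy (congrArg u (Subtype.ext h))
    obtain ⟨i, hi⟩ := Function.ne_iff.1 this
    exact mem_iUnion.2 ⟨i + 1, i, Nat.lt_succ_self i, hi⟩
  have hUmono : Monotone U := fun M N hMN p ⟨i, hi, h⟩ => ⟨i, hi.trans_le hMN, h⟩
  obtain ⟨N, hN⟩ := hK.elim_directed_cover U hUopen hUcover hUmono.directed_le
  refine ⟨N, fun x y hxy => ?_⟩
  by_contra hne
  obtain ⟨i, hi, h⟩ := hN (show (x, y) ∈ {p : ↥X × ↥X | u p.1 ≠ u p.2} from hne)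
  exact h (hxy i hi)

/-- Continuous integer-valued functions on a Sturmian subshift have bounded discrepancy along the
orbits of the rotation, with mean in `ℤ + αℤ`. -/
lemma exists_hasBoundedDiscrepancy_of_continuous {α : ℝ} (hα : α ∈ Ioo (0 : ℝ) 1)
    {u : ↥(sturmianN α) → ℤ} (hu : Continuous u) : ∃ θ ∈ ZplusAZ α,
      HasBoundedDiscrepancy α (fun t => u ⟨sturmianSeqN α t, sturmianSeqN_mem α t⟩) θ := by
  obtain ⟨N, hN⟩ := exists_forall_prefix_eq (isClosed_closure.isCompact) hu
  have hfac : Function.FactorsThrough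
      (fun t => u ⟨sturmianSeqN α t, sturmianSeqN_mem α t⟩)
      (fun t => fun i : Fin N => sturmianSeqN α t i) := fun s t hst =>
    hN _ _ fun i hi => congrFun hst ⟨i, hi⟩
  obtain ⟨Φ, hΦ⟩ := (Function.factorsThrough_iff _).1 hfac
  rw [hΦ]
  exact exists_hasBoundedDiscrepancy (comp_prefix_mem_closure hα Φ)
/-! ### Continuous orbit equivalence -/

/-- The coding of `t` as a point of the Sturmian subshift. -/
def sturmianPoint (α t : ℝ) : ↥(sturmianN α) := ⟨sturmianSeqN α t, sturmianSeqN_mem α t⟩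

lemma sturmianShiftN_sturmianPoint (α t : ℝ) :
    sturmianShiftN α (sturmianPoint α t) = sturmianPoint α (t + α) := by
  apply Subtype.ext
  change shiftN (sturmianSeqN α t) = sturmianSeqN α (t + α)
  simpa using shiftN_iterate_sturmianSeqN α t 1

/-- An orbit map between Sturmian subshifts maps a two-sided orbit of codings into a two-sided
orbit of generic codings, with increments given by the cocycle `l - k`. -/
lemma exists_orbit_map {α β : ℝ} (hβ : Irrational β) (hβm : β ∈ Ioo (0 : ℝ) 1)
    {h : ↥(sturmianN α) → ↥(sturmianN β)} {k l : ↥(sturmianN α) → ℕ}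
    (heq : ∀ x : ↥(sturmianN α),
      shiftN^[l x] (h x : ℕ → Bool) = shiftN^[k x] (h (sturmianShiftN α x) : ℕ → Bool))
    {t s : ℝ} (hs : IsGeneric β s) (h0 : h (sturmianPoint α t) = sturmianPoint β s) :
    ∃ f : ℤ → ℤ, f 0 = 0 ∧ ∀ n : ℤ,
      h (sturmianPoint α (t + n * α)) = sturmianPoint β (s + f n * β) ∧
      f (n + 1) = f n + l (sturmianPoint α (t + n * α)) - k (sturmianPoint α (t + n * α)) := by
  have hstep : ∀ n : ℤ, shiftN^[l (sturmianPoint α (t + n * α))]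
      (h (sturmianPoint α (t + n * α)) : ℕ → Bool)
      = shiftN^[k (sturmianPoint α (t + n * α))]
        (h (sturmianPoint α (t + (n + 1 : ℤ) * α)) : ℕ → Bool) := by
    intro n
    rw [heq, sturmianShiftN_sturmianPoint]
    push_cast
    rw [show t + n * α + α = t + (n + 1) * α by ring]
  have hex : ∀ n : ℤ, ∃ c : ℤ,
      h (sturmianPoint α (t + n * α)) = sturmianPoint β (s + c * β) := by
    intro n
    induction n using Int.induction_on with
    | zero => exact ⟨0, by simpa using h0⟩
    | succ n ih =>
      obtain ⟨c, hc⟩ := ih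
      have h1 := hstep n
      rw [hc] at h1
      exact ⟨_, Subtype.ext
        (eq_sturmianSeqN_of_shiftN_iterate_eq hβ hβm hs (Subtype.property _) h1.symm)⟩
    | pred n ih =>
      obtain ⟨c, hc⟩ := ih
      have h1 := hstep (-n - 1)
      rw [sub_add_cancel, hc] at h1
      exact ⟨_, Subtype.ext
        (eq_sturmianSeqN_of_shiftN_iterate_eq hβ hβm hs (Subtype.property _) h1)⟩
  choose f hf using hex
  have hinj := sturmianSeqN_orbit_injective hβ hβm s
  refine ⟨f, hinj ?_, fun n => ⟨hf n, ?_⟩⟩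
  · have h1 := hf 0
    simp only [Int.cast_zero, zero_mul, add_zero, h0] at h1
    have h2 : sturmianSeqN β (s + f 0 * β) = sturmianSeqN β s := (congrArg Subtype.val h1).symm
    simpa using h2
  · have h1 := hstep n
    rw [hf (n + 1)] at h1
    have h2 := eq_sturmianSeqN_of_shiftN_iterate_eq hβ hβm hs (Subtype.property _) h1
    rw [hf n] at h2
    have h3 := hinj h2
    omega

lemma exists_generic_pair {α β : ℝ} (hα : Irrational α) (hαm : α ∈ Ioo (0 : ℝ) 1)
    (hβ : Irrational β) (hβm : β ∈ Ioo (0 : ℝ) 1) {h : ↥(sturmianN α) → ↥(sturmianN β)}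
    (hh : Function.Injective h) :
    ∃ t s : ℝ, IsGeneric α t ∧ IsGeneric β s ∧
      h (sturmianPoint α t) = sturmianPoint β s := by
  have hcount₁ : {t : ℝ | ¬ IsGeneric α t}.Countable := by
    refine (countable_range fun p : ℤ × ℤ => (p.1 + p.2 * α : ℝ)).mono fun t ht => ?_
    simp only [IsGeneric, mem_ofPred_eq, not_forall, not_not] at ht
    obtain ⟨p, q, rfl⟩ := ht
    exact ⟨(p, q), rfl⟩
  have hcount₂ : {t : ℝ | t ∈ Ioo (0 : ℝ) 1 ∧
      ∃ s, IsAngle β (h (sturmianPoint α t)).1 s ∧ ¬ IsGeneric β s}.Countable := by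
    refine MapsTo.countable_of_injOn (f := fun t => (h (sturmianPoint α t)).1)
      (fun t ht => ht.2) (fun t ht t' ht' htt' => ?_) (countable_isAngle_not_isGeneric hβ hβm)
    have h1 : sturmianSeqN α t = sturmianSeqN α t' :=
      congrArg Subtype.val (hh (Subtype.ext htt'))
    have h2 := isAngle_sturmianSeqN hαm t
    rw [h1] at h2
    have h3 := h2.unique hα (isAngle_sturmianSeqN hαm t')
    rwa [Int.fract_eq_self.2 ⟨ht.1.1.le, ht.1.2⟩, Int.fract_eq_self.2 ⟨ht'.1.1.le, ht'.1.2⟩] at h3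
  obtain ⟨t, ht, htc⟩ := ((hcount₁.union hcount₂).dense_compl ℝ).exists_mem_open
    (isOpen_Ioo (a := (0 : ℝ)) (b := 1)) ⟨1 / 2, by norm_num, by norm_num⟩
  obtain ⟨s, hs⟩ := exists_isAngle hβm (h (sturmianPoint α t)).2
  have hsg : IsGeneric β s := by
    by_contra hsg
    exact ht (Or.inr ⟨htc, s, hs, hsg⟩)
  exact ⟨t, s, by_contra fun htg => ht (Or.inl htg), hsg,
    Subtype.ext (hs.eq_sturmianSeqN_of_isGeneric hβm hsg)⟩

lemma eq_of_forall_nat_mul_abs_le {a K : ℝ} (h : ∀ n : ℕ, |n * a| ≤ K) : a = 0 := by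
  by_contra ha
  obtain ⟨n, hn⟩ := exists_nat_gt (K / |a|)
  rw [div_lt_iff₀ (abs_pos.2 ha)] at hn
  have := h n
  rw [abs_mul, Nat.abs_cast] at this
  linarith

lemma exists_forall_abs_sub_le {X : Type*} [TopologicalSpace X] [CompactSpace X] {k l : X → ℕ}
    (hk : Continuous k) (hl : Continuous l) : ∃ C : ℤ, ∀ x, |(l x : ℤ) - k x| ≤ C := by
  obtain ⟨K, hK⟩ := (isCompact_range hk).bddAbove
  obtain ⟨L, hL⟩ := (isCompact_range hl).bddAbove
  refine ⟨K + L, fun x => ?_⟩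
  have h1 : k x ≤ K := hK ⟨x, rfl⟩
  have h2 : l x ≤ L := hL ⟨x, rfl⟩
  rw [abs_le]
  constructor <;> omega

/-- A continuous orbit equivalence between Sturmian subshifts forces `β ∈ ℤ + αℤ`. -/
lemma mem_ZplusAZ_of_continuous_orbit_equivalence {α β : ℝ}
    (hα : Irrational α) (hαm : α ∈ Ioo (0 : ℝ) 1)
    (hβ : Irrational β) (hβm : β ∈ Ioo (0 : ℝ) 1)
    (h : ↥(sturmianN α) ≃ₜ ↥(sturmianN β))
    {k l : ↥(sturmianN α) → ℕ} {k' l' : ↥(sturmianN β) → ℕ}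
    (hk : Continuous k) (hl : Continuous l) (hk' : Continuous k') (hl' : Continuous l')
    (heq : ∀ x : ↥(sturmianN α),
      shiftN^[l x] (h x : ℕ → Bool) = shiftN^[k x] (h (sturmianShiftN α x) : ℕ → Bool))
    (heq' : ∀ y : ↥(sturmianN β),
      shiftN^[l' y] (h.symm y : ℕ → Bool)
        = shiftN^[k' y] (h.symm (sturmianShiftN β y) : ℕ → Bool)) :
    β ∈ ZplusAZ α := by
  have : CompactSpace ↥(sturmianN α) := isCompact_iff_compactSpace.1 isClosed_closure.isCompact
  have : CompactSpace ↥(sturmianN β) := isCompact_iff_compactSpace.1 isClosed_closure.isCompact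
  obtain ⟨t, s, ht, hs, hts⟩ := exists_generic_pair hα hαm hβ hβm h.injective
  obtain ⟨f, hf0, hf⟩ := exists_orbit_map hβ hβm heq hs hts
  obtain ⟨p, hp0, hp⟩ := exists_orbit_map hα hαm heq' ht (h.symm_apply_eq.2 hts.symm)
  obtain ⟨C, hC⟩ := exists_forall_abs_sub_le hk hl
  obtain ⟨D, hD⟩ := exists_forall_abs_sub_le hk' hl'
  have hpf : ∀ n, p (f n) = n := by
    intro n
    have h1 := (hp (f n)).1
    rw [← (hf n).1, h.symm_apply_apply] at h1
    exact (sturmianSeqN_orbit_injective hα hαm t (congrArg Subtype.val h1)).symm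
  have hfp : ∀ n, f (p n) = n := by
    intro n
    have h1 := (hf (p n)).1
    rw [← (hp n).1, h.apply_symm_apply] at h1
    exact (sturmianSeqN_orbit_injective hβ hβm s (congrArg Subtype.val h1)).symm
  obtain ⟨ε, K, hε, hK⟩ := exists_abs_sub_mul_le (f := f) (p := p) (C := C) (D := D)
    (fun n => by
      rw [(hf n).2, add_sub_assoc, add_sub_cancel_left]
      exact hC _)
    (fun n => by
      rw [(hp n).2, add_sub_assoc, add_sub_cancel_left]
      exact hD _) hpf hfp
  let u : ↥(sturmianN α) → ℤ := fun x =>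
    prefixWeight (l x) (h x) - prefixWeight (k x) (h (sturmianShiftN α x))
  have hw : Continuous fun q : ℕ × (ℕ → Bool) => prefixWeight q.1 q.2 :=
    continuous_prod_of_discrete_left.2 continuous_prefixWeight
  have hshift : Continuous (sturmianShiftN α) :=
    (continuous_shiftN.comp continuous_subtype_val).subtype_mk _
  have hu : Continuous u :=
    (hw.comp (hl.prodMk (continuous_subtype_val.comp h.continuous))).sub
      (hw.comp (hk.prodMk (continuous_subtype_val.comp (h.continuous.comp hshift))))
  obtain ⟨θ, hθ, K', hK'⟩ := exists_hasBoundedDiscrepancy_of_continuous hαm hu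
  have hustep : ∀ n : ℕ, u (sturmianPoint α (t + n * α))
      = ⌊s + f (n + 1 : ℕ) * β⌋ - ⌊s + f n * β⌋ := by
    intro n
    have h1 := (hf n).1
    have h2 := (hf (n + 1)).1
    have h3 := (hf n).2
    simp only [Int.cast_natCast] at h1 h3
    simp only [u, sturmianShiftN_sturmianPoint]
    rw [show t + n * α + α = t + ((n + 1 : ℤ) : ℝ) * α by push_cast; ring, h1, h2]
    simp only [sturmianPoint] at h3 ⊢
    rw [prefixWeight_sturmianSeqN hβm, prefixWeight_sturmianSeqN hβm]
    have h4 := congrArg (fun z : ℤ => (z : ℝ)) h3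
    push_cast at h4 ⊢
    rw [add_assoc s, add_assoc s, ← add_mul, ← add_mul, h4]
    ring_nf
  have husum : ∀ n : ℕ, ∑ j ∈ Finset.range n, (u (sturmianPoint α (t + j * α)) : ℝ)
      = ⌊s + f n * β⌋ - ⌊s⌋ := by
    intro n
    have h1 := Finset.sum_range_sub (fun j : ℕ => (⌊s + f j * β⌋ : ℝ)) n
    simp only [Nat.cast_zero, hf0, Int.cast_zero, zero_mul, add_zero] at h1
    rw [← h1]
    refine Finset.sum_congr rfl fun j _ => ?_
    rw [hustep]
    push_cast
    rfl
  have hθε : θ - ε * β = 0 := by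
    refine eq_of_forall_nat_mul_abs_le (K := K' + 1 + K) fun n => ?_
    have h1 := hK' t n
    change |∑ j ∈ Finset.range n, (u (sturmianPoint α (t + j * α)) : ℝ) - n * θ| ≤ K' at h1
    rw [husum] at h1
    have h2 : |((f n - ε * n : ℤ) : ℝ)| ≤ K := by
      have := hK n
      rw [hf0, sub_zero] at this
      exact_mod_cast this
    have h3 : |((f n - ε * n : ℤ) : ℝ) * β| ≤ K := by
      rw [abs_mul, abs_of_pos hβm.1]
      exact (mul_le_of_le_one_right (abs_nonneg _) hβm.2.le).trans h2
    have h4 := Int.floor_add_fract (s + f n * β)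
    have h5 := Int.floor_add_fract s
    have h6 := Int.fract_nonneg (s + f n * β)
    have h7 := Int.fract_lt_one (s + f n * β)
    have h8 := Int.fract_nonneg s
    have h9 := Int.fract_lt_one s
    rw [abs_le] at h1 h3 ⊢
    push_cast at h3
    constructor <;> linarith
  rcases hε with rfl | rfl
  · rwa [show β = θ by push_cast at hθε; linarith]
  · rw [show β = -θ by push_cast at hθε; linarith]
    exact neg_mem hθ

lemma eq_or_eq_one_sub_of_mem_ZplusAZ {α β : ℝ} (hα : Irrational α) (hαm : α ∈ Ioo (0 : ℝ) 1)
    (hβm : β ∈ Ioo (0 : ℝ) 1) (h : β ∈ ZplusAZ α) (h' : α ∈ ZplusAZ β) :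
    α = β ∨ α = 1 - β := by
  obtain ⟨p, q, h⟩ := h
  obtain ⟨r, s, h'⟩ := h'
  have hsq : s * q = 1 := by
    by_contra hne
    have h1 := (hα.intCast_mul (sub_ne_zero.2 (Ne.symm hne))).ne_int (r + s * p)
    rw [h] at h'
    push_cast at h1
    exact h1 (by linarith)
  obtain ⟨ha, hb⟩ := hαm
  obtain ⟨hc, hd⟩ := hβm
  rcases Int.eq_one_or_neg_one_of_mul_eq_one' hsq with ⟨-, rfl⟩ | ⟨-, rfl⟩
  · left
    push_cast at h
    have h1 : (-1 : ℝ) < p := by linarith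
    have h2 : (p : ℝ) < 1 := by linarith
    have h3 : p = 0 := by
      have h1 : -1 < p := by exact_mod_cast h1
      have h2 : p < 1 := by exact_mod_cast h2
      omega
    rw [h, h3]
    simp
  · right
    push_cast at h
    have h1 : (0 : ℝ) < p := by linarith
    have h2 : (p : ℝ) < 2 := by linarith
    have h3 : p = 1 := by
      have h1 : 0 < p := by exact_mod_cast h1
      have h2 : p < 2 := by exact_mod_cast h2
      omega
    rw [h, h3]
    simp

/-! ### The symbol exchange -/

/-- The exchange of the two symbols. -/
def symbolExchange (y : ℕ → Bool) : ℕ → Bool := fun i => !y i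

lemma continuous_symbolExchange : Continuous symbolExchange :=
  continuous_pi fun i => continuous_of_discreteTopology.comp (continuous_apply i)

lemma symbolExchange_symbolExchange (y : ℕ → Bool) :
    symbolExchange (symbolExchange y) = y := by
  funext i
  simp [symbolExchange]

lemma eventually_sturmianCode_neg_sub {α β : ℝ} (hα : α ∈ Ioo (0 : ℝ) 1) (hαβ : α = 1 - β)
    (u : ℝ) : ∀ᶠ δ in nhdsWithin (0 : ℝ) (Ioi 0),
      sturmianCode β (-u - δ) = !sturmianCode α u := by
  have h0 := Int.fract_nonneg u
  have h1 := Int.fract_lt_one u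
  have h2 := Int.floor_add_fract u
  have hfract : ∀ δ : ℝ, 0 < δ → δ < 1 - Int.fract u →
      Int.fract (-u - δ) = 1 - Int.fract u - δ := by
    intro δ hδ hδ'
    rw [Int.fract_eq_iff]
    refine ⟨by linarith, by linarith, -⌊u⌋ - 1, ?_⟩
    push_cast
    linarith
  by_cases h : 1 - α ≤ Int.fract u
  · filter_upwards [Ioo_mem_nhdsGT (sub_pos.2 h1)] with δ hδ
    unfold sturmianCode
    rw [hfract δ hδ.1 hδ.2]
    have : ¬ 1 - β ≤ 1 - Int.fract u - δ := by linarith [hδ.1]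
    simp [h, this]
  · rw [not_le] at h
    filter_upwards [Ioo_mem_nhdsGT (sub_pos.2 h)] with δ hδ
    unfold sturmianCode
    rw [hfract δ hδ.1 (by linarith [hδ.2, hα.1])]
    have : 1 - β ≤ 1 - Int.fract u - δ := by linarith [hδ.2]
    simp [h.not_ge, this]

lemma symbolExchange_mem {α β : ℝ} (hα : α ∈ Ioo (0 : ℝ) 1) (hαβ : α = 1 - β) {y : ℕ → Bool}
    (hy : y ∈ sturmianN α) : symbolExchange y ∈ sturmianN β := by
  suffices h : MapsTo symbolExchange {x | ∃ t : ℝ, x = sturmianSeqN α t} (sturmianN β) from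
    h.closure_left continuous_symbolExchange isClosed_closure hy
  rintro _ ⟨t, rfl⟩
  refine mem_closure_of_tendsto (f := fun δ : ℝ => sturmianSeqN β (-t - δ))
    (b := nhdsWithin (0 : ℝ) (Ioi 0)) ?_ (Filter.Eventually.of_forall fun δ => ⟨_, rfl⟩)
  refine tendsto_pi_nhds.2 fun i => tendsto_nhds_of_eventually_eq ?_
  filter_upwards [eventually_sturmianCode_neg_sub hα hαβ (t + i * α)] with δ hδ
  change sturmianCode β (-t - δ + i * β) = !sturmianCode α (t + i * α)
  rw [← hδ, sturmianCode, sturmianCode, hαβ,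
    show -t - δ + i * β = -(t + i * (1 - β)) - δ + i by ring, Int.fract_add_natCast]

/-- The conjugacy between `X_α` and `X_{1-α}` exchanging the two symbols. -/
def sturmianExchange {α β : ℝ} (hα : α ∈ Ioo (0 : ℝ) 1) (hβ : β ∈ Ioo (0 : ℝ) 1)
    (hαβ : α = 1 - β) : ↥(sturmianN α) ≃ₜ ↥(sturmianN β) where
  toFun x := ⟨symbolExchange x.1, symbolExchange_mem hα hαβ x.2⟩
  invFun y := ⟨symbolExchange y.1, symbolExchange_mem hβ (by linarith) y.2⟩
  left_inv x := Subtype.ext (symbolExchange_symbolExchange x.1)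
  right_inv y := Subtype.ext (symbolExchange_symbolExchange y.1)
  continuous_toFun := (continuous_symbolExchange.comp continuous_subtype_val).subtype_mk _
  continuous_invFun := (continuous_symbolExchange.comp continuous_subtype_val).subtype_mk _

/-- If the one-sided Sturmian subshifts `(X_α, σ_α)` and `(X_β, σ_β)` are
continuously orbit equivalent, then they are conjugate (and hence `α = β` or `α = 1 - β`). -/
theorem sturmian_coe_implies_conjugacy (α β : ℝ)
    (hα : Irrational α) (hβ : Irrational β)
    (hαm : α ∈ Set.Ioo (0 : ℝ) 1) (hβm : β ∈ Set.Ioo (0 : ℝ) 1)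
    (h : ↥(sturmianN α) ≃ₜ ↥(sturmianN β))
    (k l : ↥(sturmianN α) → ℕ) (k' l' : ↥(sturmianN β) → ℕ)
    (hk : Continuous k) (hl : Continuous l) (hk' : Continuous k') (hl' : Continuous l')
    (heq : ∀ x : ↥(sturmianN α),
      shiftN^[l x] ((h x : ℕ → Bool)) = shiftN^[k x] ((h (sturmianShiftN α x) : ℕ → Bool)))
    (heq' : ∀ y : ↥(sturmianN β),
      shiftN^[l' y] ((h.symm y : ℕ → Bool))
        = shiftN^[k' y] ((h.symm (sturmianShiftN β y) : ℕ → Bool))) :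
    (∃ g : ↥(sturmianN α) ≃ₜ ↥(sturmianN β),
        ∀ x : ↥(sturmianN α), g (sturmianShiftN α x) = sturmianShiftN β (g x))
      ∧ (α = β ∨ α = 1 - β) := by
  have hβα := mem_ZplusAZ_of_continuous_orbit_equivalence hα hαm hβ hβm h hk hl hk' hl' heq heq'
  have hαβ := mem_ZplusAZ_of_continuous_orbit_equivalence hβ hβm hα hαm h.symm hk' hl' hk hl
    heq' heq
  have hcases := eq_or_eq_one_sub_of_mem_ZplusAZ hα hαm hβm hβα hαβ
  refine ⟨?_, hcases⟩
  rcases hcases with rfl | hαβ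
  · exact ⟨Homeomorph.refl _, fun x => rfl⟩
  · exact ⟨sturmianExchange hαm hβm hαβ, fun x => rfl⟩

end
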